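/- There exist a finite alphabet Γ and a finite set R of pairs of words over Γ such that, in the monoid M presented by the generators Γ and defining relations R (the quotient of the free monoid Γ* by the congruence generated by R), the set of words w ∈ Γ* whose image [w] in M has a right inverse (i.e., there exists t ∈ M with [w]·t = 1) is not computable: the predicate (fun w : List Γ => ∃ t : M, [w]·t = 1) is not a computable predicate. -/

import Mathlib

open Turing

namespace RInv

section model
variable {Γ : Type} [Inhabited Γ] {Q : Type}

/-- Halting of a Post-Turing machine given by its transition function, started in state `q`
with the tape `l` on the left of the head and `r` from the head onwards. -/
inductive Halts (δ : Q → Γ → Option (Q × TM0.Stmt Γ)) : Q → ListBlank Γ → ListBlank Γ → Prop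
  | halt {q l r} : δ q r.head = none → Halts δ q l r
  | write {q l r q' b} : δ q r.head = some (q', TM0.Stmt.write b) →
      Halts δ q' l (r.tail.cons b) → Halts δ q l r
  | right {q l r q'} : δ q r.head = some (q', TM0.Stmt.move Dir.right) →
      Halts δ q' (l.cons r.head) r.tail → Halts δ q l r
  | left {q l r q'} : δ q r.head = some (q', TM0.Stmt.move Dir.left) →
      Halts δ q' l.tail (r.cons l.head) → Halts δ q l r

variable {δ : Q → Γ → Option (Q × TM0.Stmt Γ)}

theorem halts_write {q l r q' b} (h : δ q r.head = some (q', TM0.Stmt.write b)) :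
    Halts δ q l r ↔ Halts δ q' l (r.tail.cons b) := by
  refine ⟨fun H => ?_, Halts.write h⟩
  cases H with
  | halt e => simp [h] at e
  | write e H => rw [h] at e; cases e; exact H
  | right e H => simp [h] at e
  | left e H => simp [h] at e

theorem halts_right {q l r q'} (h : δ q r.head = some (q', TM0.Stmt.move Dir.right)) :
    Halts δ q l r ↔ Halts δ q' (l.cons r.head) r.tail := by
  refine ⟨fun H => ?_, Halts.right h⟩
  cases H with
  | halt e => simp [h] at e
  | write e H => simp [h] at e
  | right e H => rw [h] at e; cases e; exact H
  | left e H => simp [h] at e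

theorem halts_left {q l r q'} (h : δ q r.head = some (q', TM0.Stmt.move Dir.left)) :
    Halts δ q l r ↔ Halts δ q' l.tail (r.cons l.head) := by
  refine ⟨fun H => ?_, Halts.left h⟩
  cases H with
  | halt e => simp [h] at e
  | write e H => simp [h] at e
  | right e H => simp [h] at e
  | left e H => rw [h] at e; cases e; exact H

/-- Letters: two end markers `L`, `R`, a letter `h` for the halted machine,
tape letters and states. -/
inductive Letter (Γ Q : Type)
  | L | R | h
  | s (a : Γ)
  | p (q : Q)

theorem letter_finite {Γ Q : Type} [Finite Γ] [Finite Q] : Finite (Letter Γ Q) := by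
  refine Finite.of_surjective (α := Fin 3 ⊕ (Γ ⊕ Q)) (fun x => match x with
    | .inl 0 => .L | .inl 1 => .R | .inl 2 => .h | .inr (.inl a) => .s a | .inr (.inr q) => .p q) ?_
  rintro (_ | _ | _ | a | q)
  exacts [⟨.inl 0, rfl⟩, ⟨.inl 1, rfl⟩, ⟨.inl 2, rfl⟩, ⟨.inr (.inl a), rfl⟩, ⟨.inr (.inr q), rfl⟩]

open Letter

/-- The relation attached to a transition. -/
def transRel (δ : Q → Γ → Option (Q × TM0.Stmt Γ)) (x : Q × Γ × Γ) :
    List (Letter Γ Q) × List (Letter Γ Q) :=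
  match δ x.1 x.2.1 with
  | none => ([p x.1, s x.2.1], [h])
  | some (q', TM0.Stmt.write b) => ([p x.1, s x.2.1], [p q', s b])
  | some (q', TM0.Stmt.move Dir.right) => ([p x.1, s x.2.1], [s x.2.1, p q'])
  | some (q', TM0.Stmt.move Dir.left) =>
      ([s x.2.2, p x.1, s x.2.1], [p q', s x.2.2, s x.2.1])

/-- All the relations. -/
def rels (δ : Q → Γ → Option (Q × TM0.Stmt Γ)) : Set (List (Letter Γ Q) × List (Letter Γ Q)) :=
  {([L, s default], [L]), ([s default, R], [R]), ([L, h, R], [])}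
    ∪ Set.range (fun c => ([s c, h], [h])) ∪ Set.range (fun c => ([h, s c], [h]))
    ∪ Set.range (transRel δ)

theorem rels_finite [Finite Γ] [Finite Q] : (rels δ).Finite := by
  unfold rels
  refine ((Set.Finite.union ?_ (Set.finite_range _)).union (Set.finite_range _)).union
    (Set.finite_range _)
  exact Set.toFinite _

/-- Evaluation of words in a monoid. -/
def ev {N : Type} [Monoid N] (φ : Letter Γ Q → N) (w : List (Letter Γ Q)) : N := (w.map φ).prod

section complete
variable {N : Type} [Monoid N] (φ : Letter Γ Q → N)

/-- left part of a tape -/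
noncomputable def leftEl (H : φ L * φ (s default) = φ L) (l : ListBlank Γ) : N :=
  l.liftOn (fun u => φ L * (u.reverse.map (fun a => φ (s a))).prod) (by
    rintro a b ⟨n, rfl⟩
    induction n with
    | zero => simp
    | succ n ih =>
      rw [ih, List.replicate_succ', ← List.append_assoc, List.reverse_append (as := _ ++ _)]
      simp only [List.reverse_cons, List.reverse_nil, List.nil_append, List.map_append, List.map_cons,
        List.map_nil, List.prod_append, List.prod_cons, List.prod_nil, mul_one]
      rw [← mul_assoc (φ L), H])

/-- right part of a tape -/
noncomputable def rightEl (H : φ (s default) * φ R = φ R) (l : ListBlank Γ) : N :=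
  l.liftOn (fun u => (u.map (fun a => φ (s a))).prod * φ R) (by
    rintro a b ⟨n, rfl⟩
    induction n with
    | zero => simp
    | succ n ih =>
      rw [ih, List.replicate_succ', ← List.append_assoc, List.map_append (l₁ := _ ++ _)]
      simp only [List.map_cons,
        List.map_nil, List.prod_append, List.prod_cons, List.prod_nil, mul_one]
      rw [mul_assoc, H])

theorem leftEl_cons (H : φ L * φ (s default) = φ L) (a : Γ) (l : ListBlank Γ) :
    leftEl φ H (l.cons a) = leftEl φ H l * φ (s a) := by
  induction l using ListBlank.induction_on with
  | _ l =>
  rw [ListBlank.cons_mk]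
  change φ L * _ = φ L * _ * _
  simp [mul_assoc]

theorem rightEl_cons (H : φ (s default) * φ R = φ R) (a : Γ) (l : ListBlank Γ) :
    rightEl φ H (l.cons a) = φ (s a) * rightEl φ H l := by
  induction l using ListBlank.induction_on with
  | _ l =>
  rw [ListBlank.cons_mk]
  change _ * φ R  = _ * (_ * φ R)
  simp [mul_assoc]

theorem complete_aux (H : ∀ x ∈ rels δ, ev φ x.1 = ev φ x.2)
    (HL : φ L * φ (s default) = φ L) (HR : φ (s default) * φ R = φ R) {q l r}
    (hh : Halts δ q l r) : leftEl φ HL l * φ (p q) * rightEl φ HR r = 1 := by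
  have H1 : φ L * φ h * φ R = 1 := by
    simpa [ev, mul_assoc] using H ([L, h, R], []) (by simp [rels])
  have H2 : ∀ c, φ (s c) * φ h = φ h := fun c => by
    simpa [ev] using H ([s c, h], [h]) (by simp [rels])
  have H3 : ∀ c, φ h * φ (s c) = φ h := fun c => by
    simpa [ev] using H ([h, s c], [h]) (by simp [rels])
  have H4 : ∀ q a c, ev φ (transRel δ (q, a, c)).1 = ev φ (transRel δ (q, a, c)).2 :=
    fun q a c => H _ (Or.inr ⟨_, rfl⟩)
  have hl : ∀ l, leftEl φ HL l * φ h = φ L * φ h := by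
    intro l
    induction l using ListBlank.induction_on with
    | _ l =>
    change φ L * _ * _ = _
    rw [mul_assoc]; congr 1
    induction l with
    | nil => simp
    | cons a l ih => simp [mul_assoc, H2]; simpa using ih
  have hr : ∀ l, φ h * rightEl φ HR l = φ h * φ R := by
    intro l
    induction l using ListBlank.induction_on with
    | _ l =>
    change _ * (_ * φ R) = _
    rw [← mul_assoc]; congr 1
    induction l with
    | nil => simp
    | cons a l ih => simp [← mul_assoc, H3]; simpa using ih
  induction hh with
  | @halt q l r e =>
    have h4 := H4 q r.head default
    simp [transRel, e, ev] at h4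
    rw [← r.cons_head_tail, rightEl_cons, ← mul_assoc, mul_assoc _ (φ (p q)), h4, mul_assoc, hr,
      ← mul_assoc, hl, H1]
  | @write q l r q' b e _ ih =>
    have h4 := H4 q r.head default
    simp [transRel, e, ev] at h4
    rw [← r.cons_head_tail, rightEl_cons, ← mul_assoc, mul_assoc _ (φ (p q)), h4]
    rw [rightEl_cons] at ih
    simpa [mul_assoc] using ih
  | @right q l r q' e _ ih =>
    have h4 := H4 q r.head default
    simp [transRel, e, ev] at h4
    rw [← r.cons_head_tail, rightEl_cons, ← mul_assoc, mul_assoc _ (φ (p q)), h4]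
    rw [leftEl_cons] at ih
    simpa [mul_assoc] using ih
  | @left q l r q' e _ ih =>
    have h4 := H4 q r.head l.head
    simp [transRel, e, ev] at h4
    have er : rightEl φ HR r = φ (s r.head) * rightEl φ HR r.tail := by
      rw [← rightEl_cons, r.cons_head_tail]
    have el : leftEl φ HL l = leftEl φ HL l.tail * φ (s l.head) := by
      rw [← leftEl_cons, l.cons_head_tail]
    rw [rightEl_cons] at ih
    rw [← ih, er, el]
    simp only [mul_assoc]
    congr 1
    simp only [← mul_assoc] at h4 ⊢
    rw [h4]

theorem complete (H : ∀ x ∈ rels δ, ev φ x.1 = ev φ x.2) {q} {v : List Γ}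
    (hh : Halts δ q (ListBlank.mk []) (ListBlank.mk v)) :
    ev φ (L :: p q :: (v.map s ++ [R])) = 1 := by
  have HL : φ L * φ (s default) = φ L := by
    simpa [ev] using H ([L, s default], [L]) (by simp [rels])
  have HR : φ (s default) * φ R = φ R := by
    simpa [ev] using H ([s default, R], [R]) (by simp [rels])
  have := complete_aux φ H HL HR hh
  change φ L * _ * _ * (_ * φ R) = 1 at this
  simpa [ev, mul_assoc, Function.comp_def] using this

end complete

section sound

/-- Frames of the stack of the model: either only a left part of a tape has been read, or also
a state, in which case we remember which right continuations are accepted. -/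
inductive Frame (Γ : Type) [Inhabited Γ]
  | left (l : ListBlank Γ)
  | right (P : ListBlank Γ → Prop)

open Classical in
/-- The action of letters on stacks of frames (`none` is a dead state). -/
noncomputable def act (δ : Q → Γ → Option (Q × TM0.Stmt Γ)) :
    Letter Γ Q → Option (List (Frame Γ)) → Option (List (Frame Γ))
  | L, some st => some (.left (ListBlank.mk []) :: st)
  | s a, some (.left l :: st) => some (.left (l.cons a) :: st)
  | s a, some (.right P :: st) => some (.right (fun r => P (r.cons a)) :: st)
  | p q, some (.left l :: st) => some (.right (fun r => Halts δ q l r) :: st)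
  | h, some (.left _ :: st) => some (.right (fun _ => True) :: st)
  | R, some (.right P :: st) => if P (ListBlank.mk []) then some st else none
  | _, _ => none

theorem mk_default : (ListBlank.mk [default] : ListBlank Γ) = ListBlank.mk [] := by
  refine ListBlank.ext fun i => ?_
  cases i <;> simp [ListBlank.nth_mk]

/-- Action of words -/
noncomputable def actW (δ : Q → Γ → Option (Q × TM0.Stmt Γ)) (w : List (Letter Γ Q))
    (x : Option (List (Frame Γ))) : Option (List (Frame Γ)) :=
  w.foldl (fun x a => act δ a x) x

theorem act_rels : ∀ x ∈ rels δ, ∀ y, actW δ x.1 y = actW δ x.2 y := by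
  rintro x (((hx | ⟨c, rfl⟩) | ⟨c, rfl⟩) | ⟨⟨q, a, c⟩, rfl⟩) y
  · rcases hx with rfl | rfl | rfl <;> rcases y with _ | _ | ⟨_ | _, _⟩ <;>
      simp [actW, act, mk_default]
    have e := mk_default (Γ := Γ)
    split_ifs <;> simp_all
  · rcases y with _ | _ | ⟨_ | _, _⟩ <;> simp [actW, act]
  · rcases y with _ | _ | ⟨_ | _, _⟩ <;> simp [actW, act]
  · unfold transRel
    rcases e : δ q a with _ | ⟨q', ⟨⟨⟩⟩ | b⟩ <;> simp only
    · rcases y with _ | _ | ⟨_ | _, _⟩ <;> simp [actW, act]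
      funext r
      exact eq_true (Halts.halt (by simpa using e))
    · rcases y with _ | _ | ⟨_ | _, _⟩ <;> simp [actW, act]
      funext r
      rw [halts_left (by simpa using e)]; simp
    · rcases y with _ | _ | ⟨_ | _, _⟩ <;> simp [actW, act]
      funext r
      rw [halts_right (by simpa using e)]; simp
    · rcases y with _ | _ | ⟨_ | _, _⟩ <;> simp [actW, act]
      funext r
      rw [halts_write (by simpa using e)]; simp

theorem act_none (a : Letter Γ Q) : act δ a none = none := by cases a <;> rfl

theorem actW_dead {q} {v : List Γ} (hh : ¬ Halts δ q (ListBlank.mk []) (ListBlank.mk v)) (y) :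
    actW δ (L :: p q :: (v.map s ++ [R])) y = none := by
  have h0 : ∀ (v : List Γ) P st, actW δ (v.map s) (some (.right P :: st)) =
      some (.right (fun r => P (r.append v)) :: st) := by
    intro v
    induction v with
    | nil => intro P st; rfl
    | cons a v ih =>
      intro P st
      exact ih (fun r => P (r.cons a)) st
  rcases y with _ | st
  · have : ∀ w : List (Letter Γ Q), actW δ w none = none := by
      intro w
      induction w with
      | nil => rfl
      | cons a w ih => exact (congrArg (actW δ w) (act_none a)).trans ih
    exact this _
  · have : actW δ (L :: p q :: (v.map s ++ [R])) (some st) =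
      act δ R (actW δ (v.map s)
        (some (.right (fun r => Halts δ q (ListBlank.mk []) r) :: st))) := by
      simp [actW, act]
    rw [this, h0]
    simp [act, hh]

theorem actW_append (w w' : List (Letter Γ Q)) (y) :
    actW δ (w ++ w') y = actW δ w' (actW δ w y) := by
  simp [actW]

end sound

theorem exists_pres [Finite Γ] [Finite Q] (δ : Q → Γ → Option (Q × TM0.Stmt Γ)) (q0 : Q) :
    ∃ (n : ℕ) (Rl : Finset (FreeMonoid (Fin n) × FreeMonoid (Fin n))) (aL aq aR : Fin n)
      (g : Γ → Fin n), ∀ v : List Γ,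
      (∃ t : (conGen fun x y : FreeMonoid (Fin n) => (x, y) ∈ Rl).Quotient,
          (↑(FreeMonoid.ofList (aL :: aq :: (v.map g ++ [aR]))) :
            (conGen fun x y : FreeMonoid (Fin n) => (x, y) ∈ Rl).Quotient) * t = 1) ↔
      Halts δ q0 (ListBlank.mk []) (ListBlank.mk v) := by
  classical
  have : Finite (Letter Γ Q) := letter_finite
  obtain ⟨n, ⟨e⟩⟩ := Finite.exists_equiv_fin (Letter Γ Q)
  let tr : List (Letter Γ Q) → FreeMonoid (Fin n) := fun w => FreeMonoid.ofList (w.map e)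
  let Rl : Finset (FreeMonoid (Fin n) × FreeMonoid (Fin n)) :=
    (rels_finite (δ := δ)).toFinset.image (fun x => (tr x.1, tr x.2))
  have hR : ∀ x y, (x, y) ∈ Rl ↔ ∃ z ∈ rels δ, tr z.1 = x ∧ tr z.2 = y := by
    intro x y
    simp only [Rl, Finset.mem_image, Set.Finite.mem_toFinset, Prod.mk.injEq]
  refine ⟨n, Rl, e L, e (p q0), e R, fun a => e (s a), fun v => ?_⟩
  have hw : FreeMonoid.ofList (e L :: e (p q0) :: (v.map (fun a => e (s a)) ++ [e R])) =
      tr (L :: p q0 :: (v.map s ++ [R])) := by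
    simp [tr, Function.comp_def]
  rw [hw]
  constructor
  · rintro ⟨t, ht⟩
    by_contra hh
    obtain ⟨t, rfl⟩ := Con.mk'_surjective t
    have h1 : (conGen fun x y : FreeMonoid (Fin n) => (x, y) ∈ Rl)
        (tr (L :: p q0 :: (v.map s ++ [R])) * t) 1 := by
      rw [← Con.eq]
      exact ht
    let K : Con (FreeMonoid (Fin n)) :=
      { r := fun x y => ∀ z, actW δ (x.toList.map e.symm) z = actW δ (y.toList.map e.symm) z
        iseqv := ⟨fun _ _ => rfl, fun h z => (h z).symm, fun h h' z => (h z).trans (h' z)⟩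
        mul' := by
          intro a b c d h1 h2 z
          simp only [FreeMonoid.toList_mul, List.map_append, actW_append]
          rw [h1, h2] }
    have hK : conGen (fun x y : FreeMonoid (Fin n) => (x, y) ∈ Rl) ≤ K := by
      refine Con.conGen_le.2 ?_
      intro x y hxy z
      obtain ⟨w, hw, rfl, rfl⟩ := (hR _ _).1 hxy
      simpa [tr, Function.comp_def] using act_rels w hw z
    have h2 : ∀ z, actW δ ((tr (L :: p q0 :: (v.map s ++ [R])) * t).toList.map e.symm) z =
      actW δ ((1 : FreeMonoid (Fin n)).toList.map e.symm) z := hK h1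
    have h3 : ∀ z, actW δ (t.toList.map e.symm) none = z := by
      intro z
      have := h2 z
      rw [FreeMonoid.toList_mul, List.map_append, actW_append] at this
      have e1 : (tr (L :: p q0 :: (v.map s ++ [R]))).toList.map e.symm
        = L :: p q0 :: (v.map s ++ [R]) := by
        simp [tr, Function.comp_def]
      rw [e1, actW_dead hh] at this
      rw [this]
      rfl
    have h4 := (h3 none).symm.trans (h3 (some []))
    simp at h4
  · intro hh
    refine ⟨1, ?_⟩
    rw [mul_one]
    let φ : Letter Γ Q → (conGen fun x y : FreeMonoid (Fin n) => (x, y) ∈ Rl).Quotient :=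
      fun a => ((FreeMonoid.of (e a) : FreeMonoid (Fin n)) : Con.Quotient _)
    have hev : ∀ w, ev φ w = ((tr w : FreeMonoid (Fin n)) : Con.Quotient _) := by
      intro w
      induction w with
      | nil => rfl
      | cons a w ih =>
        have : tr (a :: w) = FreeMonoid.of (e a) * tr w := rfl
        rw [this, Con.coe_mul, ← ih]
        simp [ev, φ]
    rw [← hev]
    refine complete φ ?_ hh
    intro x hx
    rw [hev, hev]
    exact (Con.eq _).2 (ConGen.Rel.of _ _ ((hR _ _).2 ⟨x, hx, rfl, rfl⟩))

end model

section machine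

theorem halts_iff {Γ Λ : Type} [Inhabited Γ] [Inhabited Λ] (M : TM0.Machine Γ Λ) {S : Finset Λ}
    (δ : S → Γ → Option (S × TM0.Stmt Γ))
    (hδ : ∀ q a, (δ q a).map (fun x => (x.1.1, x.2)) = M q.1 a) (q : S) (l r) :
    Halts δ q l r ↔ (StateTransition.eval (TM0.step M) ⟨q.1, Tape.mk' l r⟩).Dom := by
  constructor
  · intro H
    induction H with
    | @halt q l r e =>
      refine Part.dom_iff_mem.2 ⟨⟨q.1, Tape.mk' l r⟩, StateTransition.mem_eval.2 ⟨.refl, ?_⟩⟩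
      simp [TM0.step, ← hδ, e]
    | @write q l r q' b e _ ih =>
      rw [StateTransition.reaches_eval (b := ⟨q'.1, Tape.mk' l (r.tail.cons b)⟩)]
      · exact ih
      · refine .single ?_
        simp [TM0.step, ← hδ, e]
    | @right q l r q' e _ ih =>
      rw [StateTransition.reaches_eval (b := ⟨q'.1, Tape.mk' (l.cons r.head) r.tail⟩)]
      · exact ih
      · refine .single ?_
        simp [TM0.step, ← hδ, e]
    | @left q l r q' e _ ih =>
      rw [StateTransition.reaches_eval (b := ⟨q'.1, Tape.mk' l.tail (r.cons l.head)⟩)]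
      · exact ih
      · refine .single ?_
        simp [TM0.step, ← hδ, e]
  · intro H
    obtain ⟨b, hb⟩ := Part.dom_iff_mem.1 H
    obtain ⟨h1, h2⟩ := StateTransition.mem_eval.1 hb
    clear H hb
    generalize hc : (⟨q.1, Tape.mk' l r⟩ : TM0.Cfg Γ Λ) = c at h1
    induction h1 using Relation.ReflTransGen.head_induction_on generalizing q l r with
    | refl =>
      subst hc
      refine Halts.halt ?_
      simpa [TM0.step, ← hδ] using h2
    | head h1 _ ih =>
      subst hc
      simp only [TM0.step, ← hδ, Tape.mk'_head, Option.map_map, Option.mem_def,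
        Option.map_eq_some_iff] at h1
      obtain ⟨⟨q', st⟩, e, rfl⟩ := h1
      rcases st with ⟨⟨⟩⟩ | b
      · exact Halts.left e (ih _ _ _ (by simp))
      · exact Halts.right e (ih _ _ _ (by simp))
      · exact Halts.write e (ih _ _ _ (by simp))

theorem exists_tm0 {K : Type} [DecidableEq K] {G : K → Type} 
    {Λ σ : Type} [Inhabited Λ] [Inhabited σ] [Finite σ] (M : Λ → TM2.Stmt G Λ σ) (S : Finset Λ)
    (ss : TM2.Supports M S) (k : K) :
    ∃ (Q : Type) (_ : Finite Q)
      (δ : Q → TM2to1.Γ' K G → Option (Q × TM0.Stmt (TM2to1.Γ' K G))) (q0 : Q),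
      ∀ l, Halts δ q0 (ListBlank.mk []) (ListBlank.mk (TM2to1.trInit k l)) ↔
        (TM2.eval M k l).Dom := by
  have := Fintype.ofFinite σ
  have s1 := TM2to1.tr_supports M ss
  have s2 := TM1to0.tr_supports _ s1
  generalize TM1to0.trStmts (TM2to1.tr M) (TM2to1.trSupp M S) = T at s2
  have : ∀ (q : T) a, ∃ o : Option (T × TM0.Stmt (TM2to1.Γ' K G)),
      o.map (fun x => (x.1.1, x.2)) = TM1to0.tr (TM2to1.tr M) q.1 a := by
    intro q a
    rcases e : TM1to0.tr (TM2to1.tr M) q.1 a with _ | ⟨q', st⟩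
    · exact ⟨none, rfl⟩
    · exact ⟨some (⟨q', s2.2 e q.2⟩, st), rfl⟩
  choose δ hδ using this
  refine ⟨T, inferInstance, δ, ⟨default, s2.1⟩, fun l => ?_⟩
  rw [halts_iff _ δ hδ, ← TM2to1.tr_eval_dom, ← TM1to0.tr_eval]
  exact Iff.rfl

instance finite_K : Finite PartrecToTM2.K' := by
  refine Finite.of_surjective (α := Fin 4) (fun x => match x with
    | 0 => .main | 1 => .rev | 2 => .aux | 3 => .stack) ?_
  rintro (_ | _ | _ | _)
  exacts [⟨0, rfl⟩, ⟨1, rfl⟩, ⟨2, rfl⟩, ⟨3, rfl⟩]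

theorem trNat_bits (n : ℕ) : PartrecToTM2.trNat n =
    (Nat.bits n).map (fun b => cond b PartrecToTM2.Γ'.bit1 PartrecToTM2.Γ'.bit0) := by
  have h : ∀ m : PosNum, PartrecToTM2.trPosNum m =
    (Nat.bits (m : ℕ)).map (fun b => cond b PartrecToTM2.Γ'.bit1 PartrecToTM2.Γ'.bit0) := by
    intro m
    induction m with
    | one => simp [PartrecToTM2.trPosNum]
    | bit0 m ih =>
      have : ((PosNum.bit0 m : PosNum) : ℕ) = 2 * (m : ℕ) := by
        rw [PosNum.cast_bit0]; omega
      rw [this, Nat.bit0_bits _ (PosNum.cast_pos m).ne']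
      simp [PartrecToTM2.trPosNum, ih]
    | bit1 m ih =>
      have : ((PosNum.bit1 m : PosNum) : ℕ) = 2 * (m : ℕ) + 1 := by
        rw [PosNum.cast_bit1]; omega
      rw [this, Nat.bit1_bits]
      simp [PartrecToTM2.trPosNum, ih]
  unfold PartrecToTM2.trNat
  have h2 : ((n : Num) : ℕ) = n := Num.to_of_nat n
  rcases e : (n : Num) with _ | m
  · rw [e] at h2
    subst h2
    simp [PartrecToTM2.trNum]
  · rw [e] at h2
    change ((m : PosNum) : ℕ) = n at h2
    rw [← h2]
    exact h m

theorem primrec_bits : Primrec Nat.bits := by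
  have : Primrec₂ (fun (_ : Unit) n => Nat.bits n) := by
    refine Primrec.nat_strong_rec _ (g := fun _ l => if l.length = 0 then some [] else
      (l[l.length.div2]?).map (fun x => l.length.bodd :: x)) ?_ ?_
    · have hl : Primrec (fun x : Unit × List (List Bool) => x.2.length) :=
        Primrec.list_length.comp Primrec.snd
      refine Primrec.ite (Primrec.eq.comp hl (Primrec.const 0)) (Primrec.const _) ?_
      refine Primrec.option_map
        (Primrec.list_getElem?.comp Primrec.snd (Primrec.nat_div2.comp hl)) ?_
      exact Primrec.list_cons.comp (Primrec.nat_bodd.comp (hl.comp Primrec.fst)) Primrec.snd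
    · intro _ n
      by_cases hn : n = 0
      · simp [hn]
      · have hlt : n.div2 < n := by rw [Nat.div2_val]; omega
        have : Nat.bits n = n.bodd :: Nat.bits n.div2 := by
          conv_lhs => rw [← Nat.bit_bodd_div2 n]
          rw [Nat.bits_append_bit]
          intro h0
          by_contra hb
          apply hn
          rw [← Nat.bit_bodd_div2 n, h0]
          simp at hb
          simp [hb]
        simp [hn, hlt, this]
  exact this.comp (Primrec.const ()) Primrec.id

theorem trInit_map {K : Type} [DecidableEq K] {G : K → Type} (k : K) (f : Bool → G k) (x : G k)
    (l : List Bool) : TM2to1.trInit k (l.map f ++ [x]) =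
      (((true, Function.update (fun _ => none) k (some x)) : TM2to1.Γ' K G) ::
        l.reverse.map (fun b =>
          ((false, Function.update (fun _ => none) k (some (f b))) : TM2to1.Γ' K G))) := by
  unfold TM2to1.trInit
  rw [List.reverse_append, ← List.map_reverse]
  refine congrArg (List.cons _) ?_
  change List.map _ (List.map _ _) = _
  exact List.map_map

theorem exists_machine (f : ℕ →. ℕ) (hf : Partrec f) :
    ∃ (Γ : Type) (_ : Inhabited Γ) (_ : Finite Γ) (Q : Type) (_ : Finite Q)
      (δ : Q → Γ → Option (Q × TM0.Stmt Γ)) (q0 : Q) (a : Γ) (g : Bool → Γ),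
      ∀ n, Halts δ q0 (ListBlank.mk []) (ListBlank.mk (a :: (Nat.bits n).reverse.map g)) ↔
        (f n).Dom := by
  obtain ⟨c, hc⟩ := ToPartrec.Code.exists_code (Nat.Partrec'.part_iff₁.2 hf)
  obtain ⟨Q, hQ, δ, q0, H⟩ := @exists_tm0 PartrecToTM2.K' _ (fun _ => PartrecToTM2.Γ')
    PartrecToTM2.Λ' (Option PartrecToTM2.Γ') ⟨PartrecToTM2.trNormal c PartrecToTM2.Cont'.halt⟩
    _ _ PartrecToTM2.tr _ (PartrecToTM2.tr_supports c PartrecToTM2.Cont'.halt)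
    PartrecToTM2.K'.main
  have hfin : Finite (TM2to1.Γ' PartrecToTM2.K' (fun _ => PartrecToTM2.Γ')) :=
    inferInstanceAs (Finite (Bool × (PartrecToTM2.K' → Option PartrecToTM2.Γ')))
  refine ⟨TM2to1.Γ' PartrecToTM2.K' (fun _ => PartrecToTM2.Γ'), inferInstance, hfin, Q, hQ, δ, q0,
    (true, Function.update (fun _ => none) PartrecToTM2.K'.main (some PartrecToTM2.Γ'.cons)),
    fun b => (false, Function.update (fun _ => none) PartrecToTM2.K'.main
      (some (cond b PartrecToTM2.Γ'.bit1 PartrecToTM2.Γ'.bit0))), fun n => ?_⟩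
  have h1 := H (PartrecToTM2.trList [n])
  have h2 : (f n).Dom ↔ (StateTransition.eval (TM2.step PartrecToTM2.tr)
      (PartrecToTM2.init c [n])).Dom := by
    have h3 := hc ⟨[n], rfl⟩
    change c.eval [n] = pure <$> f n at h3
    rw [PartrecToTM2.tr_eval, h3]
    exact Iff.rfl
  rw [h2]
  convert h1 using 3
  · rw [PartrecToTM2.trList, PartrecToTM2.trList, trNat_bits]
    exact (trInit_map _ _ _ _).symm
  · change _ ↔ (StateTransition.eval _ _).Dom
    have : PartrecToTM2.init c [n] = @TM2.init _ _ _ _ 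
      ⟨PartrecToTM2.trNormal c PartrecToTM2.Cont'.halt⟩ _ _ PartrecToTM2.K'.main
        (PartrecToTM2.trList [n]) := by
      unfold PartrecToTM2.init TM2.init
      congr 1
      funext k
      cases k <;> rfl
    rw [this]

end machine
end RInv

theorem stmt_18 :
    ∃ (n : ℕ) (R : Finset (FreeMonoid (Fin n) × FreeMonoid (Fin n))),
      ¬ ComputablePred (fun w : List (Fin n) =>
        ∃ t : (conGen fun x y : FreeMonoid (Fin n) => (x, y) ∈ R).Quotient,
          (↑(FreeMonoid.ofList w) :
            (conGen fun x y : FreeMonoid (Fin n) => (x, y) ∈ R).Quotient) * t = 1) := by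
  have hf : Partrec (fun n : ℕ => (Denumerable.ofNat Nat.Partrec.Code n).eval 0) :=
    Nat.Partrec.Code.eval_part.comp (Computable.ofNat _) (Computable.const 0)
  obtain ⟨Γ, _, _, Q, _, δ, q0, a, g, H⟩ := RInv.exists_machine _ hf
  obtain ⟨n, Rl, aL, aq, aR, g', H'⟩ := RInv.exists_pres δ q0
  refine ⟨n, Rl, fun hcomp => ComputablePred.halting_problem 0 ?_⟩
  have hF : Primrec (fun c : Nat.Partrec.Code =>
      aL :: aq :: ((a :: (Nat.bits (Encodable.encode c)).reverse.map g).map g' ++ [aR])) := by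
    have h1 : Primrec (fun c : Nat.Partrec.Code =>
        ((Nat.bits (Encodable.encode c)).reverse.map (fun b => g' (g b)))) :=
      Primrec.list_map (Primrec.list_reverse.comp (RInv.primrec_bits.comp Primrec.encode))
        ((Primrec.dom_finite (fun b => g' (g b))).comp Primrec.snd).to₂
    have h2 := Primrec.list_concat.comp h1 (Primrec.const aR)
    have h3 := Primrec.list_cons.comp (Primrec.const aL) (Primrec.list_cons.comp (Primrec.const aq)
      (Primrec.list_cons.comp (Primrec.const (g' a)) h2))
    refine h3.of_eq fun c => ?_
    simp [Function.comp_def]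
  refine ComputablePred.computable_of_manyOneReducible ⟨_, hF.to_comp, fun c => ?_⟩ hcomp
  rw [H', H]
  simp
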